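/- arXiv:1708.09021 — 2 statements merged into one kernel-verified Lean document; each statement's English description precedes it below -/
import Mathlib

section
/- (Consensus graph splitting with sparsity penalty) Let N ≥ 1, let 1 ≤ k ≤ N, and let η > 1/(N − k + 1). Let A ∈ ℝ^{N×N} be a symmetric matrix with nonnegative entries satisfying A·1 = 1, and suppose its consensus objective value satisfies μ(A) + η·tr(I_N − A) ≤ 1 (as holds for any minimizer of the sparsity-penalized consensus problem, since the identity matrix attains value 1). Then the null space of the weighted graph Laplacian L = diag(A·1) − A = I_N − A has dimension at least k; equivalently, the graph associated with A has at least k connected components. -/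
open Matrix

/-- Weighted graph Laplacian `L = diag(A·1) − A`. -/
noncomputable def lap {N : ℕ} (A : Matrix (Fin N) (Fin N) ℝ) : Matrix (Fin N) (Fin N) ℝ :=
  Matrix.diagonal (A.mulVec 1) - A

/-- The `N × N` all-ones matrix `11ᵀ`. -/
def onesMat (N : ℕ) : Matrix (Fin N) (Fin N) ℝ := Matrix.of fun _ _ => (1 : ℝ)

/-- The simple graph associated with `A`: distinct `i, j` are adjacent iff `A i j ≠ 0`. -/
def graphOf {N : ℕ} (A : Matrix (Fin N) (Fin N) ℝ) : SimpleGraph (Fin N) :=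
  SimpleGraph.fromRel fun i j => A i j ≠ 0

/-- `eigsDesc A i` is the `i`-th largest eigenvalue (1-indexed, with multiplicity)
of the real symmetric matrix `A`. -/
noncomputable def eigsDesc {N : ℕ} (A : Matrix (Fin N) (Fin N) ℝ) (i : ℕ) : ℝ :=
  if hA : A.IsHermitian then
    ((Finset.univ.val.map hA.eigenvalues).sort (· ≤ ·)).reverse.getD (i - 1) 0
  else 0

/-- `μ(A) = max{λ₂(A), −λ_N(A)}`. -/
noncomputable def muA {N : ℕ} (A : Matrix (Fin N) (Fin N) ℝ) : ℝ :=
  max (eigsDesc A 2) (-(eigsDesc A N))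

lemma list_bound (l : List ℝ) (hl : 2 ≤ l.length) (hs : l.Pairwise (· ≥ ·)) (h1 : ∀ x ∈ l, x ≤ 1) :
    l.sum ≤ 1 + ((l.length : ℝ) - 1) * l.getD 1 0 := by
  match l, hl, hs, h1 with
  | a :: b :: t, _, hs, h1 =>
    have ha : a ≤ 1 := h1 a (by simp)
    have ht : t.sum ≤ t.length • b := by
      apply List.sum_le_card_nsmul
      intro x hx
      simp only [List.pairwise_cons] at hs
      exact hs.2.1 x hx
    simp only [nsmul_eq_mul] at ht
    simp
    linarith

lemma eig_le_one {N : ℕ} (A : Matrix (Fin N) (Fin N) ℝ) (hA : A.IsHermitian)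
    (hnn : ∀ i j, 0 ≤ A i j) (hrow : ∀ i, ∑ j, A i j = 1) (i : Fin N) :
    hA.eigenvalues i ≤ 1 := by
  have h : Module.End.HasEigenvalue (Matrix.toLin' A) (hA.eigenvalues i) := by
    apply Module.End.hasEigenvalue_of_hasEigenvector
      (x := (hA.eigenvectorBasis i : Fin N → ℝ))
    refine ⟨?_, ?_⟩
    · rw [Module.End.mem_eigenspace_iff, Matrix.toLin'_apply]
      exact hA.mulVec_eigenvectorBasis i
    · intro h0
      have := hA.eigenvectorBasis.toBasis.ne_zero i
      apply this
      ext j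
      simpa using congrFun h0 j
  obtain ⟨k, hk⟩ := eigenvalue_mem_ball h
  rw [Metric.mem_closedBall, Real.dist_eq] at hk
  have h2 := (abs_le.1 hk).2
  have h3 : ∑ j ∈ Finset.univ.erase k, ‖A k j‖ = ∑ j ∈ Finset.univ.erase k, A k j :=
    Finset.sum_congr rfl fun j _ => by rw [Real.norm_eq_abs, abs_of_nonneg (hnn k j)]
  have h4 := Finset.add_sum_erase Finset.univ (fun j => A k j) (Finset.mem_univ k)
  have h5 := hrow k
  linarith

lemma trace_bound {N : ℕ} (hN : 2 ≤ N) (A : Matrix (Fin N) (Fin N) ℝ) (hA : A.IsHermitian)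
    (hnn : ∀ i j, 0 ≤ A i j) (hrow : ∀ i, ∑ j, A i j = 1) :
    A.trace ≤ 1 + ((N : ℝ) - 1) * eigsDesc A 2 := by
  have hlen : ((Finset.univ.val.map hA.eigenvalues).sort (· ≤ ·)).reverse.length = N := by simp
  have hb := list_bound ((Finset.univ.val.map hA.eigenvalues).sort (· ≤ ·)).reverse
    (by rw [hlen]; exact hN)
    (by
      rw [List.pairwise_reverse]
      exact Multiset.pairwise_sort _ _)
    (by
      intro x hx
      simp only [List.mem_reverse, Multiset.mem_sort, Multiset.mem_map] at hx
      obtain ⟨i, _, rfl⟩ := hx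
      exact eig_le_one A hA hnn hrow i)
  rw [hlen] at hb
  have hsum : ((Finset.univ.val.map hA.eigenvalues).sort (· ≤ ·)).reverse.sum = A.trace := by
    rw [List.sum_reverse, ← Multiset.sum_coe, Multiset.sort_eq, hA.trace_eq_sum_eigenvalues]
    simp [List.sum_ofFn]
  rw [hsum] at hb
  unfold eigsDesc
  rw [dif_pos hA]
  exact hb

/-- Consensus graph splitting with sparsity penalty: if `η > 1/(N − k + 1)` and the
doubly-stochastic symmetric `A` has objective value `μ(A) + η·tr(I − A) ≤ 1`, then
the null space of `L = diag(A·1) − A = I − A` has dimension at least `k`;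
equivalently, the graph of `A` has at least `k` connected components. -/
theorem stmt_9 {N k : ℕ} (hN : 1 ≤ N) (hk1 : 1 ≤ k) (hkN : k ≤ N) (η : ℝ)
    (hη : 1 / ((N : ℝ) - (k : ℝ) + 1) < η)
    (A : Matrix (Fin N) (Fin N) ℝ) (hA : A.IsSymm) (hnn : ∀ i j, 0 ≤ A i j)
    (hrow : A.mulVec 1 = 1)
    (hobj : muA A + η * Matrix.trace ((1 : Matrix (Fin N) (Fin N) ℝ) - A) ≤ 1) :
    k ≤ Module.finrank ℝ (LinearMap.ker (lap A).mulVecLin) ∧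
    k ≤ Nat.card (graphOf A).ConnectedComponent := by
  have hrow' : ∀ i, ∑ j, A i j = 1 := fun i => by
    have := congrFun hrow i
    simpa [Matrix.mulVec, dotProduct] using this
  have hH : A.IsHermitian := by
    rw [Matrix.IsHermitian, Matrix.conjTranspose_eq_transpose_of_trivial]; exact hA
  have hdiag : ∀ i, A i i ≤ 1 := fun i => by
    rw [← hrow' i]
    exact Finset.single_le_sum (f := fun j => A i j) (fun j _ => hnn i j) (Finset.mem_univ i)
  haveI : Nonempty (Fin N) := ⟨⟨0, hN⟩⟩
  rcases Nat.lt_or_ge k 2 with hk | hk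
  · obtain rfl : k = 1 := by omega
    constructor
    · rw [Nat.one_le_iff_ne_zero, ← Nat.pos_iff_ne_zero, Module.finrank_pos_iff_exists_ne_zero]
      refine ⟨⟨1, ?_⟩, ?_⟩
      · rw [LinearMap.mem_ker, Matrix.mulVecLin_apply, lap, Matrix.sub_mulVec, hrow]
        ext i
        simp [Matrix.mulVec_diagonal]
      · intro h
        have := congrFun (congrArg Subtype.val h) ⟨0, hN⟩
        simp at this
    · exact Nat.card_pos
  · have hN2 : 2 ≤ N := hk.trans hkN
    have htb := trace_bound hN2 A hH hnn hrow'
    have hmu : eigsDesc A 2 ≤ muA A := le_max_left _ _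
    have htr : Matrix.trace ((1 : Matrix (Fin N) (Fin N) ℝ) - A) = N - A.trace := by
      rw [Matrix.trace_sub, Matrix.trace_one, Fintype.card_fin]
    have htr2 : Matrix.trace ((1 : Matrix (Fin N) (Fin N) ℝ) - A) = ∑ i, (1 - A i i) := by
      simp [Matrix.trace]
    have h0 : 0 ≤ Matrix.trace ((1 : Matrix (Fin N) (Fin N) ℝ) - A) := by
      rw [htr2]
      exact Finset.sum_nonneg fun i _ => sub_nonneg.2 (hdiag i)
    have hkr : (2 : ℝ) ≤ k := by exact_mod_cast hk
    have hkNr : (k : ℝ) ≤ N := by exact_mod_cast hkN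
    have hpos : 0 < (N : ℝ) - k + 1 := by linarith
    have hη0 : 0 < η := lt_trans (by positivity) hη
    have hη1 : 1 < η * ((N : ℝ) - k + 1) := by rwa [div_lt_iff₀ hpos] at hη
    have hη2 : 1 < η * ((N : ℝ) - 1) := by nlinarith
    have hz : Matrix.trace ((1 : Matrix (Fin N) (Fin N) ℝ) - A) = 0 := by
      set T := Matrix.trace ((1 : Matrix (Fin N) (Fin N) ℝ) - A) with hT
      set m := 1 - eigsDesc A 2 with hm
      have e1 : η * T ≤ m := by linarith
      have e2 : ((N : ℝ) - 1) * m ≤ T := by rw [htr, hm]; linarith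
      have e3 : m ≤ 0 := by
        by_contra hc
        push Not at hc
        have e4 : η * (((N : ℝ) - 1) * m) ≤ η * T := mul_le_mul_of_nonneg_left e2 hη0.le
        nlinarith
      nlinarith
    rw [htr2, Finset.sum_eq_zero_iff_of_nonneg fun i _ => sub_nonneg.2 (hdiag i)] at hz
    have hA1 : A = 1 := by
      ext i j
      have hii : A i i = 1 := by linarith [hz i (Finset.mem_univ i)]
      by_cases hij : i = j
      · subst hij; simp [hii]
      · rw [Matrix.one_apply_ne hij]
        have h4 := Finset.add_sum_erase Finset.univ (fun j => A i j) (Finset.mem_univ i)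
        have h5 := Finset.single_le_sum (f := fun j => A i j) (fun j _ => hnn i j)
          (Finset.mem_erase.2 ⟨Ne.symm hij, Finset.mem_univ j⟩)
        have h6 := hrow' i
        linarith [hnn i j]
    subst hA1
    constructor
    · have hl : lap (1 : Matrix (Fin N) (Fin N) ℝ) = 0 := by
        rw [lap, hrow]
        ext i j
        simp [Matrix.diagonal_apply, Matrix.one_apply]
      rw [hl, Matrix.mulVecLin_zero, LinearMap.ker_zero, finrank_top]
      simpa using hkN
    · have hg : graphOf (1 : Matrix (Fin N) (Fin N) ℝ) = ⊥ := by
        ext i j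
        simp only [graphOf, SimpleGraph.fromRel_adj, SimpleGraph.bot_adj, iff_false]
        rintro ⟨hij, h | h⟩
        · exact h (Matrix.one_apply_ne hij)
        · exact h (Matrix.one_apply_ne hij.symm)
      rw [hg]
      have hinj : Function.Injective
          (⊥ : SimpleGraph (Fin N)).connectedComponentMk := by
        intro i j hij
        simpa using SimpleGraph.ConnectedComponent.exact hij
      have := Nat.card_le_card_of_injective _ hinj
      rw [Nat.card_fin] at this
      exact hkN.trans this
end

section
/- Let N ≥ 1, let η > 1, and let A ∈ ℝ^{N×N} be a symmetric matrix with nonnegative entries satisfying A·1 = 1 and μ(A) + η·tr(I_N − A) ≤ 1. Then the graph associated with A has N connected components, i.e., it is completely disconnected: A_{kl} = 0 for all k ≠ l, and hence A = I_N. -/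
open Matrix

/-- For `η > 1`, a feasible `A` with objective value `μ(A) + η·tr(I − A) ≤ 1` yields a
completely disconnected graph: `N` connected components, zero off-diagonal entries,
and hence `A = I`. -/
theorem stmt_11 {N : ℕ} (hN : 1 ≤ N) (η : ℝ) (hη : 1 < η)
    (A : Matrix (Fin N) (Fin N) ℝ) (hA : A.IsSymm) (hnn : ∀ i j, 0 ≤ A i j)
    (hrow : A.mulVec 1 = 1)
    (hobj : muA A + η * Matrix.trace ((1 : Matrix (Fin N) (Fin N) ℝ) - A) ≤ 1) :
    Nat.card (graphOf A).ConnectedComponent = N ∧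
    (∀ k l, k ≠ l → A k l = 0) ∧ A = 1 := by
  have hH : A.IsHermitian := by
    rw [Matrix.IsHermitian, Matrix.conjTranspose_eq_transpose_of_trivial]
    exact hA
  have hsum : ∀ k, ∑ j, A k j = 1 := by
    intro k
    have := congrFun hrow k
    simpa [Matrix.mulVec, dotProduct] using this
  have hdiag : ∀ k, A k k ≤ 1 := fun k => by
    rw [← hsum k]
    exact Finset.single_le_sum (fun j _ => hnn k j) (Finset.mem_univ k)
  -- every eigenvalue is at most one (Gershgorin)
  have hle : ∀ i, hH.eigenvalues i ≤ 1 := by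
    intro i
    have hev : Module.End.HasEigenvalue (Matrix.toLin' A) (hH.eigenvalues i) := by
      rw [Module.End.hasEigenvalue_iff_mem_spectrum, Matrix.spectrum_toLin']
      exact hH.eigenvalues_mem_spectrum_real i
    obtain ⟨k, hk⟩ := eigenvalue_mem_ball hev
    rw [Metric.mem_closedBall, Real.dist_eq] at hk
    have h1 : ∑ j ∈ Finset.univ.erase k, ‖A k j‖ = ∑ j ∈ Finset.univ.erase k, A k j :=
      Finset.sum_congr rfl fun j _ => by rw [Real.norm_eq_abs, abs_of_nonneg (hnn k j)]
    have h2 := Finset.add_sum_erase Finset.univ (fun j => A k j) (Finset.mem_univ k)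
    have h3 := hsum k
    have h4 := le_abs_self (hH.eigenvalues i - A k k)
    linarith
  have htr : Matrix.trace ((1 : Matrix (Fin N) (Fin N) ℝ) - A) = ∑ k, (1 - A k k) := by
    simp [Matrix.trace]
  have htr2 : Matrix.trace ((1 : Matrix (Fin N) (Fin N) ℝ) - A)
      = ∑ i, (1 - hH.eigenvalues i) := by
    rw [Matrix.trace_sub, hH.trace_eq_sum_eigenvalues]
    simp
  have hzero : ∑ k, (1 - A k k) ≤ 0 := by
    rcases Nat.lt_or_ge N 2 with h | h
    · obtain rfl : N = 1 := by omega
      have := hsum 0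
      simp at this
      simp [this]
    · have hmem : ∃ i, eigsDesc A 2 = hH.eigenvalues i := by
        have hlen : 2 - 1 <
            ((Finset.univ.val.map hH.eigenvalues).sort (· ≤ ·)).reverse.length := by
          simp
          omega
        have hm := List.getElem_mem hlen
        rw [List.mem_reverse, Multiset.mem_sort, Multiset.mem_map] at hm
        obtain ⟨i, -, hi⟩ := hm
        refine ⟨i, ?_⟩
        rw [eigsDesc, dif_pos hH, hi, List.getD_eq_getElem _ _ hlen]
      obtain ⟨i, hi⟩ := hmem
      have h1 : 1 - hH.eigenvalues i ≤ ∑ i, (1 - hH.eigenvalues i) :=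
        Finset.single_le_sum (f := fun i => 1 - hH.eigenvalues i)
          (fun j _ => sub_nonneg.2 (hle j)) (Finset.mem_univ i)
      have h2 : eigsDesc A 2 ≤ muA A := le_max_left _ _
      rw [← htr2, htr] at h1
      rw [htr] at hobj
      nlinarith
  have hone : ∀ k, A k k = 1 := by
    intro k
    have := Finset.single_le_sum (f := fun k => 1 - A k k)
      (fun j _ => sub_nonneg.2 (hdiag j)) (Finset.mem_univ k)
    have := hdiag k
    linarith
  have hoff : ∀ k l, k ≠ l → A k l = 0 := by
    intro k l hkl
    have h2 := Finset.add_sum_erase Finset.univ (fun j => A k j) (Finset.mem_univ k)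
    have h3 := Finset.single_le_sum (f := fun j => A k j) (s := Finset.univ.erase k)
      (fun j _ => hnn k j) (Finset.mem_erase.2 ⟨hkl.symm, Finset.mem_univ l⟩)
    have := hsum k
    have := hone k
    have := hnn k l
    linarith
  have hA1 : A = 1 := by
    ext k l
    by_cases h : k = l
    · subst h; simp [hone]
    · rw [hoff k l h, Matrix.one_apply_ne h]
  refine ⟨?_, hoff, hA1⟩
  have hbot : graphOf A = ⊥ := by
    ext a b
    simp only [graphOf, SimpleGraph.fromRel_adj, SimpleGraph.bot_adj, iff_false]
    rintro ⟨hab, h | h⟩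
    · exact h (hoff a b hab)
    · exact h (hoff b a hab.symm)
  rw [hbot]
  have hbij : Function.Bijective
      (fun v => (⊥ : SimpleGraph (Fin N)).connectedComponentMk v) := by
    constructor
    · intro a b hab
      have := SimpleGraph.ConnectedComponent.exact hab
      simpa using this
    · intro c
      induction c using SimpleGraph.ConnectedComponent.ind with
      | _ v => exact ⟨v, rfl⟩
  rw [← Nat.card_eq_of_bijective _ hbij]
  simp
end
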